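/- Let k ≥ 1 be an integer and set h = 1/k. Let u : ℝ → ℝ be twice continuously differentiable on [0,1] with u(0) = u(1) = 0, and let I_k u : ℝ → ℝ be the piecewise linear interpolant of u on the mesh {0, h, 2h, …, 1}, i.e. the function that is affine on each interval [ih, (i+1)h] and satisfies (I_k u)(ih) = u(ih) for all i ∈ {0,…,k}. Then ∫_0^1 (u′(x) − (I_k u)′(x))² dx ≤ (h/π)² · ∫_0^1 u″(x)² dx, where (I_k u)′ denotes the piecewise derivative, equal to the constant slope (u((i+1)h) − u(ih))/h on each open mesh interval (ih, (i+1)h). -/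

import Mathlib

/-- Piecewise linear interpolant of `u` on the mesh `{0, 1/k, …, 1}`:
on each mesh interval `[i/k, (i+1)/k)` it is the affine function agreeing with `u`
at the nodes `i/k` and `(i+1)/k`. -/
noncomputable def Ik (k : ℕ) (u : ℝ → ℝ) (x : ℝ) : ℝ :=
  u ((⌊x * k⌋ : ℝ) / k) +
    (u (((⌊x * k⌋ : ℝ) + 1) / k) - u ((⌊x * k⌋ : ℝ) / k)) * (x * k - (⌊x * k⌋ : ℝ))

/-- Piecewise derivative of the interpolant: on each open mesh interval
`(i/k, (i+1)/k)` it equals the constant slope `(u((i+1)/k) - u(i/k)) / (1/k)`. -/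
noncomputable def IkDeriv (k : ℕ) (u : ℝ → ℝ) (x : ℝ) : ℝ :=
  (u (((⌊x * k⌋ : ℝ) + 1) / k) - u ((⌊x * k⌋ : ℝ) / k)) * k

open Set MeasureTheory in
/-- A `C²` function vanishing at the endpoints of `[a, b]` satisfies `c² ∫ e'² ≤ ∫ e''²`
for every `c` below the first Dirichlet frequency `π / (b - a)`. -/
theorem sq_mul_integral_sq_deriv_le_of_lt {a b c : ℝ} (hab : a < b) (hc : 0 ≤ c)
    (hcb : c * (b - a) < Real.pi) {e e' e'' : ℝ → ℝ}
    (he : ∀ x ∈ Icc a b, HasDerivWithinAt e (e' x) (Icc a b) x)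
    (he' : ∀ x ∈ Icc a b, HasDerivWithinAt e' (e'' x) (Icc a b) x)
    (hcont : ContinuousOn e'' (Icc a b)) (ha : e a = 0) (hb : e b = 0) :
    c ^ 2 * ∫ x in a..b, e' x ^ 2 ≤ ∫ x in a..b, e'' x ^ 2 := by
  set m := (a + b) / 2 with hm
  set t : ℝ → ℝ := fun x => Real.tan (c * (x - m)) with ht
  have hcos : ∀ x ∈ Icc a b, Real.cos (c * (x - m)) ≠ 0 := by
    intro x hx
    apply ne_of_gt
    apply Real.cos_pos_of_mem_Ioo
    constructor <;> nlinarith [hx.1, hx.2, mul_nonneg hc (sub_nonneg.2 hx.1),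
      mul_nonneg hc (sub_nonneg.2 hx.2)]
  have htd : ∀ x ∈ Icc a b, HasDerivAt t ((1 + t x ^ 2) * c) x := by
    intro x hx
    have h1 : HasDerivAt (fun y : ℝ => c * (y - m)) c x := by
      simpa using ((hasDerivAt_id x).sub_const m).const_mul c
    have h2 := (Real.hasDerivAt_tan (hcos x hx)).comp x h1
    have h3 : 1 / Real.cos (c * (x - m)) ^ 2 = 1 + t x ^ 2 := by
      rw [ht, one_div, ← Real.inv_one_add_tan_sq (hcos x hx), inv_inv]
    rw [h3] at h2
    exact h2
  have hec : ContinuousOn e (Icc a b) := fun x hx => (he x hx).continuousWithinAt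
  have hec' : ContinuousOn e' (Icc a b) := fun x hx => (he' x hx).continuousWithinAt
  have htc : ContinuousOn t (Icc a b) := fun x hx => (htd x hx).continuousAt.continuousWithinAt
  have hint : ∀ f : ℝ → ℝ, ContinuousOn f (Icc a b) → IntervalIntegrable f volume a b :=
    fun f hf => hf.intervalIntegrable_of_Icc hab.le
  have hflux : ∫ x in a..b, ((e'' x + c ^ 2 * e x) ^ 2 + c ^ 2 * (e' x + c * t x * e x) ^ 2
      - (e'' x ^ 2 - c ^ 2 * e' x ^ 2)) = 0 := by
    rw [intervalIntegral.integral_eq_sub_of_hasDerivAt_of_le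
      (f := fun x => 2 * c ^ 2 * (e x * e' x) + c ^ 3 * (t x * e x ^ 2)) hab.le]
    · simp [ha, hb]
    · fun_prop
    · intro x hx
      have hn := Icc_mem_nhds hx.1 hx.2
      have hx' := Ioo_subset_Icc_self hx
      have d := (he x hx').hasDerivAt hn
      have d' := (he' x hx').hasDerivAt hn
      refine (((d.mul d').const_mul (2 * c ^ 2)).add
        (((htd x hx').mul (d.pow 2)).const_mul (c ^ 3))).congr_deriv ?_
      simp only [Pi.pow_apply]
      push_cast
      ring
    · exact hint _ (by fun_prop)
  have hnonneg : 0 ≤ ∫ x in a..b,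
      ((e'' x + c ^ 2 * e x) ^ 2 + c ^ 2 * (e' x + c * t x * e x) ^ 2) :=
    intervalIntegral.integral_nonneg hab.le fun x _ => by positivity
  rw [intervalIntegral.integral_sub (hint _ (by fun_prop)) (hint _ (by fun_prop)),
    intervalIntegral.integral_sub (hint _ (by fun_prop)) (hint _ (by fun_prop)),
    intervalIntegral.integral_const_mul] at hflux
  linarith

open Set MeasureTheory Filter Topology in
/-- Sharp Poincaré-type inequality for `C²` functions vanishing at the endpoints of `[a, b]`. -/
theorem integral_sq_deriv_le_of_eq_zero {a b : ℝ} (hab : a < b) {e e' e'' : ℝ → ℝ}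
    (he : ∀ x ∈ Icc a b, HasDerivWithinAt e (e' x) (Icc a b) x)
    (he' : ∀ x ∈ Icc a b, HasDerivWithinAt e' (e'' x) (Icc a b) x)
    (hcont : ContinuousOn e'' (Icc a b)) (ha : e a = 0) (hb : e b = 0) :
    ∫ x in a..b, e' x ^ 2 ≤ ((b - a) / Real.pi) ^ 2 * ∫ x in a..b, e'' x ^ 2 := by
  have hL : 0 < b - a := sub_pos.2 hab
  have hpos : 0 < Real.pi / (b - a) := div_pos Real.pi_pos hL
  have hlim : Tendsto (fun c : ℝ => c ^ 2 * ∫ x in a..b, e' x ^ 2) (𝓝[<] (Real.pi / (b - a)))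
      (𝓝 ((Real.pi / (b - a)) ^ 2 * ∫ x in a..b, e' x ^ 2)) :=
    Tendsto.mono_left (Continuous.tendsto (by fun_prop) _) nhdsWithin_le_nhds
  have key : (Real.pi / (b - a)) ^ 2 * ∫ x in a..b, e' x ^ 2 ≤ ∫ x in a..b, e'' x ^ 2 := by
    refine le_of_tendsto hlim ?_
    filter_upwards [Ioo_mem_nhdsLT hpos] with c hc
    exact sq_mul_integral_sq_deriv_le_of_lt hab hc.1.le ((lt_div_iff₀ hL).1 hc.2)
      he he' hcont ha hb
  calc ∫ x in a..b, e' x ^ 2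
      = ((b - a) / Real.pi) ^ 2 * ((Real.pi / (b - a)) ^ 2 * ∫ x in a..b, e' x ^ 2) := by
        have := Real.pi_ne_zero
        field_simp
    _ ≤ _ := by gcongr

open Set MeasureTheory in
/-- On a single interval, the derivative of a `C²` function differs from the slope of the chord
by at most `(b - a) / π` times the second derivative, in `L²`. -/
theorem integral_sq_deriv_sub_slope_le {a b : ℝ} (hab : a < b) {u u' u'' : ℝ → ℝ}
    (hu : ∀ x ∈ Icc a b, HasDerivWithinAt u (u' x) (Icc a b) x)
    (hu' : ∀ x ∈ Icc a b, HasDerivWithinAt u' (u'' x) (Icc a b) x)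
    (hcont : ContinuousOn u'' (Icc a b)) :
    ∫ x in a..b, (u' x - (u b - u a) / (b - a)) ^ 2
      ≤ ((b - a) / Real.pi) ^ 2 * ∫ x in a..b, u'' x ^ 2 := by
  have hL : b - a ≠ 0 := (sub_pos.2 hab).ne'
  refine integral_sq_deriv_le_of_eq_zero
    (e := fun x => u x - (u a + (u b - u a) / (b - a) * (x - a)))
    hab (fun x hx => ?_) (fun x hx => (hu' x hx).sub_const _) hcont (by simp) ?_
  · have h := ((((hasDerivAt_id x).sub_const a).const_mul
      ((u b - u a) / (b - a))).const_add (u a)).hasDerivWithinAt (s := Icc a b)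
    rw [mul_one] at h
    exact (hu x hx).sub h
  · field_simp
    ring

/-- On an open mesh interval the piecewise derivative is the slope of the chord. -/
theorem IkDeriv_eq_of_mem_Ioo {k : ℕ} (hk : 1 ≤ k) (u : ℝ → ℝ) {i : ℕ} {x : ℝ}
    (hx : x ∈ Set.Ioo ((i : ℝ) / k) (((i + 1 : ℕ) : ℝ) / k)) :
    IkDeriv k u x = (u (((i + 1 : ℕ) : ℝ) / k) - u ((i : ℝ) / k))
      / (((i + 1 : ℕ) : ℝ) / k - (i : ℝ) / k) := by
  have hk0 : (0 : ℝ) < k := by exact_mod_cast hk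
  have hfloor : ⌊x * k⌋ = (i : ℤ) := by
    rw [Int.floor_eq_iff]
    have h1 := (div_lt_iff₀ hk0).1 hx.1
    have h2 := (lt_div_iff₀ hk0).1 hx.2
    push_cast at h2 ⊢
    exact ⟨h1.le, h2⟩
  have hmesh : ((i + 1 : ℕ) : ℝ) / k - (i : ℝ) / k = (k : ℝ)⁻¹ := by
    push_cast
    field_simp
    ring
  rw [IkDeriv, hfloor, hmesh, div_inv_eq_mul]
  push_cast
  rfl

/-- **H¹ interpolation error estimate.**  For `u` twice continuously differentiable
on `[0,1]` with `u 0 = u 1 = 0`, the piecewise linear interpolant on the mesh of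
size `h = 1/k` satisfies `∫_0^1 (u' - (I_k u)')² ≤ (h/π)² ∫_0^1 u''²`. -/
theorem interpolation_error_H1
    (k : ℕ) (hk : 1 ≤ k) (h : ℝ) (hh : h = 1 / k) (u u' u'' : ℝ → ℝ)
    (hderiv : ∀ x ∈ Set.Icc (0 : ℝ) 1, HasDerivWithinAt u (u' x) (Set.Icc (0 : ℝ) 1) x)
    (hderiv' : ∀ x ∈ Set.Icc (0 : ℝ) 1, HasDerivWithinAt u' (u'' x) (Set.Icc (0 : ℝ) 1) x)
    (hcont : ContinuousOn u'' (Set.Icc (0 : ℝ) 1))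
    (h0 : u 0 = 0) (h1 : u 1 = 0) :
    ∫ x in (0 : ℝ)..1, (u' x - IkDeriv k u x) ^ 2
      ≤ (h / Real.pi) ^ 2 * ∫ x in (0 : ℝ)..1, (u'' x) ^ 2 := by
  have hk0 : (0 : ℝ) < k := by exact_mod_cast hk
  set p : ℕ → ℝ := fun i => (i : ℝ) / k with hp
  have hmesh : ∀ i, p (i + 1) - p i = h := fun i => by
    simp only [hp, hh]
    push_cast
    field_simp
    ring
  have hlt : ∀ i, p i < p (i + 1) := fun i => by
    have : 0 < h := by rw [hh]; positivity
    linarith [hmesh i]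
  have hsub : ∀ i < k, Set.Icc (p i) (p (i + 1)) ⊆ Set.Icc 0 1 := fun i hi =>
    Set.Icc_subset_Icc (by positivity) ((div_le_one hk0).2 (by exact_mod_cast hi))
  have hcont' : ContinuousOn u' (Set.Icc 0 1) := fun x hx => (hderiv' x hx).continuousWithinAt
  have hslope : ∀ i, Set.EqOn
      (fun x => (u' x - (u (p (i + 1)) - u (p i)) / (p (i + 1) - p i)) ^ 2)
      (fun x => (u' x - IkDeriv k u x) ^ 2) (Set.Ioo (p i) (p (i + 1))) := fun i x hx => by
    simp only [IkDeriv_eq_of_mem_Ioo hk u hx, p]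
  have hint : ∀ i < k, IntervalIntegrable (fun x => (u' x - IkDeriv k u x) ^ 2)
      MeasureTheory.volume (p i) (p (i + 1)) := fun i hi => by
    have hc := hcont'.mono (hsub i hi)
    refine (ContinuousOn.intervalIntegrable_of_Icc (hlt i).le (by fun_prop)).congr_uIoo
      (f := fun x => (u' x - (u (p (i + 1)) - u (p i)) / (p (i + 1) - p i)) ^ 2) ?_
    rw [Set.uIoo_of_le (hlt i).le]
    exact hslope i
  have hint'' : ∀ i < k, IntervalIntegrable (fun x => u'' x ^ 2)
      MeasureTheory.volume (p i) (p (i + 1)) := fun i hi =>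
    ContinuousOn.intervalIntegrable_of_Icc (hlt i).le ((hcont.mono (hsub i hi)).pow 2)
  have hp0 : p 0 = 0 := by simp [hp]
  have hpk : p k = 1 := div_self hk0.ne'
  rw [← hp0, ← hpk, ← intervalIntegral.sum_integral_adjacent_intervals hint,
    ← intervalIntegral.sum_integral_adjacent_intervals hint'', Finset.mul_sum]
  refine Finset.sum_le_sum fun i hi => ?_
  have hi := Finset.mem_range.1 hi
  have hloc := integral_sq_deriv_sub_slope_le (hlt i)
    (fun x hx => (hderiv x (hsub i hi hx)).mono (hsub i hi))
    (fun x hx => (hderiv' x (hsub i hi hx)).mono (hsub i hi)) (hcont.mono (hsub i hi))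
  rw [intervalIntegral.integral_congr_Ioo_of_le (hlt i).le (hslope i), hmesh i] at hloc
  exact hloc
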